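/- Let p > 3 be prime. The number of orbits of the conjugation action of Aut(M₁) (viewed as a subgroup of Hol(M₁)) on the set of regular subgroups of Hol(M₁) that are elementary abelian of order p³ (i.e., isomorphic to (ZMod p)³) equals 2p + 1. (Equivalently, up to isomorphism there are exactly 2p + 1 skew braces with multiplicative group C_p³ and additive group M₁.) -/

import Mathlib

/-! ## The Heisenberg group of order `p³` -/

@[ext]
structure Heisenberg (p : ℕ) where
  x : ZMod p
  y : ZMod p
  z : ZMod p

namespace Heisenberg

variable {p : ℕ}

instance : Mul (Heisenberg p) :=
  ⟨fun g h => ⟨g.x + h.x, g.y + h.y, g.z + h.z + h.x * g.y⟩⟩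

instance : One (Heisenberg p) := ⟨⟨0, 0, 0⟩⟩

instance : Inv (Heisenberg p) := ⟨fun g => ⟨-g.x, -g.y, -g.z + g.x * g.y⟩⟩

@[simp] theorem mul_x (g h : Heisenberg p) : (g * h).x = g.x + h.x := rfl
@[simp] theorem mul_y (g h : Heisenberg p) : (g * h).y = g.y + h.y := rfl
@[simp] theorem mul_z (g h : Heisenberg p) : (g * h).z = g.z + h.z + h.x * g.y := rfl
@[simp] theorem one_x : (1 : Heisenberg p).x = 0 := rfl
@[simp] theorem one_y : (1 : Heisenberg p).y = 0 := rfl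
@[simp] theorem one_z : (1 : Heisenberg p).z = 0 := rfl
@[simp] theorem inv_x (g : Heisenberg p) : (g⁻¹).x = -g.x := rfl
@[simp] theorem inv_y (g : Heisenberg p) : (g⁻¹).y = -g.y := rfl
@[simp] theorem inv_z (g : Heisenberg p) : (g⁻¹).z = -g.z + g.x * g.y := rfl

instance : Group (Heisenberg p) where
  mul_assoc a b c := by ext <;> simp <;> ring
  one_mul a := by ext <;> simp
  mul_one a := by ext <;> simp
  inv_mul_cancel a := by ext <;> simp <;> ring

/-- The generator `ρ` (a generator of the centre). -/
def ρ : Heisenberg p := ⟨0, 0, 1⟩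

/-- The generator `σ`. -/
def σ : Heisenberg p := ⟨1, 0, 0⟩

/-- The generator `τ`. -/
def τ : Heisenberg p := ⟨0, 1, 0⟩

/-- The automorphism `α₁` determined by `σ ↦ ρσ`, `τ ↦ τ` (and `ρ ↦ ρ`). -/
def α₁ : MulAut (Heisenberg p) where
  toFun g := ⟨g.x, g.y, g.z + g.x⟩
  invFun g := ⟨g.x, g.y, g.z - g.x⟩
  left_inv g := by ext <;> simp
  right_inv g := by ext <;> simp
  map_mul' g h := by ext <;> simp <;> ring

/-- The automorphism `α₃` determined by `σ ↦ σ`, `τ ↦ ρτ` (and `ρ ↦ ρ`). -/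
def α₃ : MulAut (Heisenberg p) where
  toFun g := ⟨g.x, g.y, g.z + g.y⟩
  invFun g := ⟨g.x, g.y, g.z - g.y⟩
  left_inv g := by ext <;> simp
  right_inv g := by ext <;> simp
  map_mul' g h := by ext <;> simp <;> ring

/-- The automorphism `α₂` determined by `σ ↦ στ`, `τ ↦ τ` (and `ρ ↦ ρ`), for `p` an odd
prime. -/
def α₂ (p : ℕ) [Fact p.Prime] (hp : p ≠ 2) : MulAut (Heisenberg p) where
  toFun g := ⟨g.x, g.x + g.y, g.z + g.x * (g.x - 1) / 2⟩
  invFun g := ⟨g.x, g.y - g.x, g.z - g.x * (g.x - 1) / 2⟩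
  left_inv g := by ext <;> simp <;> ring
  right_inv g := by ext <;> simp <;> ring
  map_mul' g h := by
    have h2 : (2 : ZMod p) ≠ 0 := by
      intro h
      have h' : ((2 : ℕ) : ZMod p) = 0 := by exact_mod_cast h
      rw [CharP.cast_eq_zero_iff (ZMod p) p 2] at h'
      have h1 := Nat.le_of_dvd (by norm_num) h'
      have h2 := (Fact.out : p.Prime).two_le
      omega
    ext <;> simp
    · ring
    · field_simp
      ring

end Heisenberg

open Heisenberg

/-! ## The holomorph of `M₁` inside the permutation group -/

/-- The left regular representation `M₁ → Perm M₁`. -/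
def leftMulHom (p : ℕ) : Heisenberg p →* Equiv.Perm (Heisenberg p) :=
  MulAction.toPermHom (Heisenberg p) (Heisenberg p)

/-- The holomorph of `M₁`, realized as the subgroup of `Perm M₁` generated by left
translations and automorphisms of `M₁`. -/
def Hol (p : ℕ) : Subgroup (Equiv.Perm (Heisenberg p)) :=
  (leftMulHom p).range ⊔
    (MulAut.toPerm (Heisenberg p)).range

/-- A subgroup of `Perm X` is regular if it acts freely and transitively on `X`. -/
def IsRegularSub {X : Type*} (H : Subgroup (Equiv.Perm X)) : Prop :=
  ∀ x y : X, ∃! g : Equiv.Perm X, g ∈ H ∧ g x = y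

/-- The canonical projection `Θ : Hol(M₁) → Aut(M₁)` (with kernel the left translations),
written as a function on permutations: it sends `π` to `m ↦ (π 1)⁻¹ * π m`; on elements of the
holomorph, this is exactly the automorphism component. -/
def theta (p : ℕ) (π : Equiv.Perm (Heisenberg p)) : Equiv.Perm (Heisenberg p) :=
  (Equiv.mulLeft (π 1))⁻¹ * π

/-- The cardinality of the image `Θ(G)` of a subgroup `G` of the holomorph under the canonical
projection `Θ`. -/
noncomputable def thetaCard (p : ℕ) (G : Subgroup (Equiv.Perm (Heisenberg p))) : ℕ :=
  Nat.card (theta p '' (G : Set (Equiv.Perm (Heisenberg p))))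

/-- The conjugation action of `Aut(M₁)` (viewed inside `Perm M₁`) on subgroups of `Perm M₁`. -/
def autConj (p : ℕ) (α : MulAut (Heisenberg p)) (G : Subgroup (Equiv.Perm (Heisenberg p))) :
    Subgroup (Equiv.Perm (Heisenberg p)) :=
  Subgroup.map (MulAut.conj (MulAut.toPerm (Heisenberg p) α)).toMonoidHom G



namespace Heisenberg

variable {p : ℕ} [Fact p.Prime]

/-- The coordinate space `𝔽_p³`. -/
abbrev Vec (p : ℕ) := ZMod p × ZMod p × ZMod p

/-- Logarithmic coordinates, in which left translations become affine maps and automorphisms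
become linear maps. -/
def logEquiv (p : ℕ) [Fact p.Prime] : Heisenberg p ≃ Vec p where
  toFun g := (g.x, g.y, g.z - g.x * g.y / 2)
  invFun v := ⟨v.1, v.2.1, v.2.2 + v.1 * v.2.1 / 2⟩
  left_inv g := by ext <;> simp
  right_inv v := by simp

theorem two_ne_zero_zmod (h3 : 3 < p) : (2 : ZMod p) ≠ 0 := by
  intro h
  have h' : ((2 : ℕ) : ZMod p) = 0 := by exact_mod_cast h
  rw [ZMod.natCast_eq_zero_iff] at h'
  have := Nat.le_of_dvd (by norm_num) h'
  omega

theorem three_ne_zero_zmod (h3 : 3 < p) : (3 : ZMod p) ≠ 0 := by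
  intro h
  have h' : ((3 : ℕ) : ZMod p) = 0 := by exact_mod_cast h
  rw [ZMod.natCast_eq_zero_iff] at h'
  have := Nat.le_of_dvd (by norm_num) h'
  omega

@[simp] theorem logEquiv_one : logEquiv p 1 = 0 := by
  simp [logEquiv]

theorem logEquiv_mul (h2 : (2 : ZMod p) ≠ 0) (g h : Heisenberg p) :
    logEquiv p (g * h) = logEquiv p g + logEquiv p h +
      (0, 0, (g.y * h.x - g.x * h.y) / 2) := by
  simp only [logEquiv, Equiv.coe_fn_mk, mul_x, mul_y, mul_z, Prod.mk_add_mk, Prod.mk.injEq]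
  refine ⟨by ring, by ring, ?_⟩
  field_simp
  ring

/-- The linear maps preserving the line of the centre and acting on it by the determinant of
the induced map on the quotient. -/
def IsAutLinear (T : Vec p →ₗ[ZMod p] Vec p) : Prop :=
  ∃ a b c d m n : ZMod p, a * d - b * c ≠ 0 ∧ ∀ x y w : ZMod p,
    T (x, y, w) = (a * x + b * y, c * x + d * y, m * x + n * y + (a * d - b * c) * w)

theorem IsAutLinear.comp {S T : Vec p →ₗ[ZMod p] Vec p} (hS : IsAutLinear S)
    (hT : IsAutLinear T) : IsAutLinear (S ∘ₗ T) := by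
  obtain ⟨a, b, c, d, m, n, h, hS⟩ := hS
  obtain ⟨a', b', c', d', m', n', h', hT⟩ := hT
  refine ⟨a * a' + b * c', a * b' + b * d', c * a' + d * c', c * b' + d * d',
    m * a' + n * c' + (a * d - b * c) * m', m * b' + n * d' + (a * d - b * c) * n', ?_, ?_⟩
  · have := mul_ne_zero h h'
    convert this using 1
    ring
  · intro x y w
    simp only [LinearMap.comp_apply, hT, hS, Prod.mk.injEq]
    refine ⟨by ring, by ring, by ring⟩

/-- The linear part of the left translation by `g` in logarithmic coordinates. -/
def shear (g : Heisenberg p) : Vec p →ₗ[ZMod p] Vec p where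
  toFun v := (v.1, v.2.1, v.2.2 + (g.y * v.1 - g.x * v.2.1) / 2)
  map_add' v w := by ext <;> simp; ring
  map_smul' r v := by ext <;> simp; ring

theorem isAutLinear_shear (g : Heisenberg p) : IsAutLinear (shear g) := by
  refine ⟨1, 0, 0, 1, g.y / 2, - g.x / 2, by simp, fun x y w => ?_⟩
  ext <;> simp [shear]
  ring

theorem logEquiv_mul_eq_shear (h2 : (2 : ZMod p) ≠ 0) (g h : Heisenberg p) :
    logEquiv p (g * h) = logEquiv p g + shear g (logEquiv p h) := by
  rw [logEquiv_mul h2, add_assoc]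
  congr 1
  ext <;> simp [shear, logEquiv]

theorem shear_shear_inv (g : Heisenberg p) (v : Vec p) : shear g (shear g⁻¹ v) = v := by
  ext <;> simp [shear]
  ring

theorem IsAutLinear.injective {T : Vec p →ₗ[ZMod p] Vec p} (hT : IsAutLinear T) :
    Function.Injective T := by
  obtain ⟨a, b, c, d, m, n, h, hT⟩ := hT
  rw [← LinearMap.ker_eq_bot, LinearMap.ker_eq_bot']
  rintro ⟨x, y, w⟩ hv
  simp only [hT, Prod.mk_eq_zero] at hv
  obtain ⟨h1, h2, h3⟩ := hv
  have hx : x = 0 := mul_left_cancel₀ h (by linear_combination d * h1 - b * h2)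
  have hy : y = 0 := mul_left_cancel₀ h (by linear_combination a * h2 - c * h1)
  have hw : w = 0 := mul_left_cancel₀ h (by rw [hx, hy] at h3; linear_combination h3)
  simp [hx, hy, hw]

instance : Finite (Heisenberg p) := Finite.of_equiv _ (logEquiv p).symm

theorem IsAutLinear.exists_mulAut (h2 : (2 : ZMod p) ≠ 0) {T : Vec p →ₗ[ZMod p] Vec p}
    (hT : IsAutLinear T) :
    ∃ α : MulAut (Heisenberg p), ∀ g, logEquiv p (α g) = T (logEquiv p g) := by
  let f : Heisenberg p →* Heisenberg p := MonoidHom.mk'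
    (fun g => (logEquiv p).symm (T (logEquiv p g))) (by
      intro g h
      apply (logEquiv p).injective
      rw [logEquiv_mul h2, logEquiv_mul h2]
      obtain ⟨a, b, c, d, m, n, -, hT⟩ := hT
      simp only [map_add, Equiv.apply_symm_apply]
      congr 1
      simp only [hT]
      simp only [logEquiv, Equiv.coe_fn_mk, Equiv.coe_fn_symm_mk, Prod.mk.injEq]
      refine ⟨by ring, by ring, by ring⟩)
  have hf : Function.Injective f := fun g h hgh =>
    (logEquiv p).injective (hT.injective ((logEquiv p).symm.injective hgh))
  refine ⟨MulEquiv.ofBijective f (Finite.injective_iff_bijective.mp hf), fun g => ?_⟩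
  simp [f]

theorem mulAut_exists_isAutLinear (h2 : (2 : ZMod p) ≠ 0) (α : MulAut (Heisenberg p)) :
    ∃ T : Vec p →ₗ[ZMod p] Vec p, IsAutLinear T ∧
      ∀ g, logEquiv p (α g) = T (logEquiv p g) := by
  have center_apply : ∀ s : ZMod p, (α ⟨0, 0, s⟩).x = 0 ∧ (α ⟨0, 0, s⟩).y = 0 := by
    intro s
    have hc : ∀ g, α ⟨0, 0, s⟩ * g = g * α ⟨0, 0, s⟩ := by
      intro g
      obtain ⟨g, rfl⟩ := α.surjective g
      rw [← map_mul, ← map_mul]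
      congr 1
      ext <;> simp [add_comm]
    have h1 := congrArg Heisenberg.z (hc σ)
    have h2 := congrArg Heisenberg.z (hc τ)
    simp [σ, τ] at h1 h2
    exact ⟨by linear_combination h2, by linear_combination h1⟩
  have map_mul_half : ∀ g h : Heisenberg p,
      (α ⟨0, 0, (g.x * h.y - g.y * h.x) / 2⟩).z =
        ((α g).x * (α h).y - (α g).y * (α h).x) / 2 := by
    intro g h
    set s := (g.x * h.y - g.y * h.x) / 2 with hs
    have e : h * g = g * h * ⟨0, 0, s⟩ * ⟨0, 0, s⟩ := by
      ext
      · simp [add_comm]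
      · simp [add_comm]
      · simp only [mul_y, mul_z, hs]
        field_simp
        ring
    have h1 := congrArg (fun t => (α t).z) e
    simp [center_apply] at h1
    field_simp
    linear_combination -h1
  let A : Vec p →+ Vec p := AddMonoidHom.mk'
    (fun v => logEquiv p (α ((logEquiv p).symm v))) (by
      intro v w
      set g := (logEquiv p).symm v with hg
      set h := (logEquiv p).symm w with hh
      have e : (logEquiv p).symm (v + w) = g * h * ⟨0, 0, (g.x * h.y - g.y * h.x) / 2⟩ := by
        apply (logEquiv p).injective
        rw [logEquiv_mul h2, logEquiv_mul h2]
        simp only [Equiv.apply_symm_apply, hg, hh]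
        ext <;> simp [logEquiv]
        ring
      rw [e, map_mul α, map_mul α, logEquiv_mul h2, logEquiv_mul h2]
      have hz := map_mul_half g h
      have hc := center_apply ((g.x * h.y - g.y * h.x) / 2)
      ext <;> simp [logEquiv, hc, hz]
      ring)
  let T := A.toZModLinearMap p
  have hT : ∀ g, logEquiv p (α g) = T (logEquiv p g) := fun g => by simp [T, A]
  have inj : Function.Injective T := by
    intro v w h
    simpa [T, A] using h
  refine ⟨T, ?_, hT⟩
  have hσ := hT σ
  have hτ := hT τ
  have hρ := hT ρ
  have hc := center_apply 1
  have hz : (α ρ).z = (α σ).x * (α τ).y - (α σ).y * (α τ).x := by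
    have e : (ρ : Heisenberg p) = ⟨0, 0, (σ.x * τ.y - σ.y * τ.x) / 2⟩ *
        ⟨0, 0, (σ.x * τ.y - σ.y * τ.x) / 2⟩ := by
      ext <;> simp [ρ, σ, τ]
      field_simp
      norm_num
    rw [e, map_mul, mul_z, map_mul_half σ τ, (center_apply _).1]
    field_simp
    ring
  change (α ρ).x = 0 ∧ (α ρ).y = 0 at hc
  have key : ∀ x y w : ZMod p, T (x, y, w) =
      ((α σ).x * x + (α τ).x * y, (α σ).y * x + (α τ).y * y,
       (logEquiv p (α σ)).2.2 * x + (logEquiv p (α τ)).2.2 * y +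
        ((α σ).x * (α τ).y - (α τ).x * (α σ).y) * w) := by
    intro x y w
    have e : (x, y, w) = x • logEquiv p σ + y • logEquiv p τ + w • logEquiv p ρ := by
      ext <;> simp [logEquiv, σ, τ, ρ]
    rw [e, map_add, map_add, map_smul, map_smul, map_smul, ← hσ, ← hτ, ← hρ]
    ext <;> simp [logEquiv, hc, hz] <;> ring
  refine ⟨_, _, _, _, _, _, ?_, key⟩
  intro h0
  have h1 := key 0 0 1
  rw [h0] at h1
  have : ((0 : ZMod p), (0 : ZMod p), (1 : ZMod p)) = 0 := inj (by rw [h1]; simp)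
  simp at this

theorem mem_Hol_iff {π : Equiv.Perm (Heisenberg p)} :
    π ∈ Hol p ↔ ∃ (h : Heisenberg p) (α : MulAut (Heisenberg p)), ∀ g, π g = h * α g := by
  constructor
  · intro hπ
    let K : Subgroup (Equiv.Perm (Heisenberg p)) :=
      { carrier := {π | ∃ (h : Heisenberg p) (α : MulAut (Heisenberg p)), ∀ g, π g = h * α g}
        one_mem' := ⟨1, 1, fun g => by simp⟩
        mul_mem' := by
          rintro _ _ ⟨h, α, H⟩ ⟨k, β, K⟩
          exact ⟨h * α k, α * β, fun g => by simp [H, K, mul_assoc]⟩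
        inv_mem' := by
          rintro π ⟨h, α, H⟩
          refine ⟨α⁻¹ h⁻¹, α⁻¹, fun g => ?_⟩
          rw [Equiv.Perm.inv_eq_iff_eq, H]
          simp }
    have hK : Hol p ≤ K := by
      refine sup_le ?_ ?_
      · rintro _ ⟨h, rfl⟩
        exact ⟨h, 1, fun g => rfl⟩
      · rintro _ ⟨α, rfl⟩
        exact ⟨1, α, fun g => by rw [one_mul]; rfl⟩
    exact hK hπ
  · rintro ⟨h, α, H⟩
    have : π = leftMulHom p h * MulAut.toPerm _ α := by
      ext1 g
      rw [H]
      rfl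
    rw [this]
    exact mul_mem (Subgroup.mem_sup_left ⟨h, rfl⟩) (Subgroup.mem_sup_right ⟨α, rfl⟩)

theorem mem_Hol_iff_affine (h2 : (2 : ZMod p) ≠ 0) {π : Equiv.Perm (Heisenberg p)} :
    π ∈ Hol p ↔ ∃ (t : Vec p) (T : Vec p →ₗ[ZMod p] Vec p), IsAutLinear T ∧
      ∀ g, logEquiv p (π g) = t + T (logEquiv p g) := by
  rw [mem_Hol_iff]
  constructor
  · rintro ⟨h, α, H⟩
    obtain ⟨T, hT, hα⟩ := mulAut_exists_isAutLinear h2 α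
    refine ⟨logEquiv p h, shear h ∘ₗ T, (isAutLinear_shear h).comp hT, fun g => ?_⟩
    rw [H, logEquiv_mul_eq_shear h2, hα, LinearMap.comp_apply]
  · rintro ⟨t, T, hT, H⟩
    set h := (logEquiv p).symm t with hh
    obtain ⟨α, hα⟩ := ((isAutLinear_shear h⁻¹).comp hT).exists_mulAut h2
    refine ⟨h, α, fun g => (logEquiv p).injective ?_⟩
    rw [H, logEquiv_mul_eq_shear h2, hα, LinearMap.comp_apply, shear_shear_inv]
    simp [hh]

/-- `G` consists of the circle translations `w ↦ v + w + m v w` (in logarithmic coordinates)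
of the algebra with multiplication `m`. -/
def Represents (G : Subgroup (Equiv.Perm (Heisenberg p)))
    (m : Vec p →ₗ[ZMod p] Vec p →ₗ[ZMod p] Vec p) : Prop :=
  (∀ v, ∃ π ∈ G, ∀ g, logEquiv p (π g) = v + logEquiv p g + m v (logEquiv p g)) ∧
    ∀ π ∈ G, ∃ v, ∀ g, logEquiv p (π g) = v + logEquiv p g + m v (logEquiv p g)

theorem Represents.autConj_eq_iff {G G' : Subgroup (Equiv.Perm (Heisenberg p))}
    {m m' : Vec p →ₗ[ZMod p] Vec p →ₗ[ZMod p] Vec p} (hG : Represents G m)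
    (hG' : Represents G' m') {α : MulAut (Heisenberg p)} {T : Vec p →ₗ[ZMod p] Vec p}
    (hα : ∀ g, logEquiv p (α g) = T (logEquiv p g)) :
    autConj p α G = G' ↔ ∀ v w, T (m v w) = m' (T v) (T w) := by
  have conj_apply : ∀ (π : Equiv.Perm (Heisenberg p)) g,
      ((MulAut.conj (MulAut.toPerm (Heisenberg p) α)).toMonoidHom π) (α g) = α (π g) := by
    intro π g
    change α (π (α⁻¹ (α g))) = _
    simp
  constructor
  · rintro rfl v w
    obtain ⟨π, hπ, H⟩ := hG.1 v
    obtain ⟨v', H'⟩ := hG'.2 _ (Subgroup.mem_map_of_mem _ hπ)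
    have key : ∀ w, T (v + w + m v w) = v' + T w + m' v' (T w) := by
      intro w
      have := H' (α ((logEquiv p).symm w))
      rw [conj_apply, hα, hα, H] at this
      simpa using this
    obtain rfl : T v = v' := by simpa using key 0
    simpa using key w
  · intro hm
    have conj_log : ∀ (π : Equiv.Perm (Heisenberg p)) (v : Vec p),
        (∀ g, logEquiv p (π g) = v + logEquiv p g + m v (logEquiv p g)) →
        ∀ g, logEquiv p ((MulAut.conj (MulAut.toPerm (Heisenberg p) α)).toMonoidHom π g) =
          T v + logEquiv p g + m' (T v) (logEquiv p g) := by
      intro π v H g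
      obtain ⟨g, rfl⟩ := α.surjective g
      rw [conj_apply, hα, H, hα, map_add, map_add, hm]
    apply le_antisymm
    · rintro _ ⟨π, hπ, rfl⟩
      obtain ⟨v, H⟩ := hG.2 π hπ
      obtain ⟨π', hπ', H'⟩ := hG'.1 (T v)
      convert hπ' using 1
      ext1 g
      apply (logEquiv p).injective
      rw [H']
      exact conj_log π v H g
    · intro π' hπ'
      obtain ⟨v', H'⟩ := hG'.2 π' hπ'
      obtain ⟨v, rfl⟩ : ∃ v, T v = v' := by
        obtain ⟨g, hg⟩ := α.surjective ((logEquiv p).symm v')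
        exact ⟨logEquiv p g, by rw [← hα, hg]; simp⟩
      obtain ⟨π, hπ, H⟩ := hG.1 v
      refine ⟨π, hπ, ?_⟩
      ext1 g
      apply (logEquiv p).injective
      rw [H']
      exact conj_log π v H g

/-- The commutative multiplication on `𝔽_p³` with `e₁² = ε e₂ + A e₃`, `e₁ e₂ = C e₃`,
`e₂² = D e₃`, and `e₃` annihilating everything. -/
def normalMul (ε A C D : ZMod p) : Vec p →ₗ[ZMod p] Vec p →ₗ[ZMod p] Vec p :=
  LinearMap.mk₂ (ZMod p) (fun v w => (0, ε * (v.1 * w.1),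
      A * (v.1 * w.1) + C * (v.1 * w.2.1 + v.2.1 * w.1) + D * (v.2.1 * w.2.1)))
    (by intros; ext <;> simp <;> ring) (by intros; ext <;> simp <;> ring)
    (by intros; ext <;> simp <;> ring) (by intros; ext <;> simp <;> ring)

theorem normalMul_apply (ε A C D : ZMod p) (v w : Vec p) : normalMul ε A C D v w =
    (0, ε * (v.1 * w.1),
      A * (v.1 * w.1) + C * (v.1 * w.2.1 + v.2.1 * w.1) + D * (v.2.1 * w.2.1)) := rfl

theorem existsUnique_normalMul (ε A C D : ZMod p) (s t : Vec p) :
    ∃! v, v + s + normalMul ε A C D v s = t := by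
  obtain ⟨s₁, s₂, s₃⟩ := s
  obtain ⟨t₁, t₂, t₃⟩ := t
  set y := t₂ - s₂ - ε * ((t₁ - s₁) * s₁) with hy
  refine ⟨(t₁ - s₁, y, t₃ - s₃ -
    (A * ((t₁ - s₁) * s₁) + C * ((t₁ - s₁) * s₂ + y * s₁) + D * (y * s₂))), ?_, ?_⟩
  · simp only [normalMul_apply, Prod.mk_add_mk, Prod.mk.injEq, hy]
    exact ⟨by ring, by ring, by ring⟩
  · rintro ⟨x, y', w⟩ h
    simp only [normalMul_apply, Prod.mk_add_mk, Prod.mk.injEq] at h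
    obtain ⟨rfl, rfl, rfl⟩ := h
    simp only [hy, Prod.mk.injEq]
    exact ⟨by ring, by ring, by ring⟩

/-- The map `v ↦ exp v - 1` of the algebra `normalMul ε A C D`. -/
def expEquiv (ε A C D : ZMod p) : Vec p ≃ Vec p where
  toFun v := (v.1, v.2.1 + ε * v.1 ^ 2 / 2,
    v.2.2 + (A * v.1 ^ 2 + 2 * C * v.1 * v.2.1 + D * v.2.1 ^ 2) / 2 + C * ε * v.1 ^ 3 / 6)
  invFun v := (v.1, v.2.1 - ε * v.1 ^ 2 / 2,
    v.2.2 - (A * v.1 ^ 2 + 2 * C * v.1 * (v.2.1 - ε * v.1 ^ 2 / 2) +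
      D * (v.2.1 - ε * v.1 ^ 2 / 2) ^ 2) / 2 - C * ε * v.1 ^ 3 / 6)
  left_inv v := by
    ext <;> simp
    ring
  right_inv v := by
    ext <;> simp
    ring

theorem expEquiv_add (h3 : 3 < p) {ε A C D : ZMod p} (h : ε * D = 0) (v w : Vec p) :
    expEquiv ε A C D (v + w) = expEquiv ε A C D v + expEquiv ε A C D w +
      normalMul ε A C D (expEquiv ε A C D v) (expEquiv ε A C D w) := by
  have h2 := two_ne_zero_zmod h3
  have h3 := three_ne_zero_zmod h3
  have h6 : (6 : ZMod p) = 2 * 3 := by norm_num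
  simp only [expEquiv, Equiv.coe_fn_mk, normalMul_apply, Prod.fst_add, Prod.snd_add,
    Prod.mk_add_mk, Prod.mk.injEq, h6]
  refine ⟨by ring, by field_simp; ring, ?_⟩
  rcases mul_eq_zero.mp h with rfl | rfl <;> field_simp <;> ring

theorem exists_represents_normalMul (h3 : 3 < p) {ε A C D : ZMod p} (h : ε * D = 0) :
    ∃ G : Subgroup (Equiv.Perm (Heisenberg p)), (G ≤ Hol p ∧ IsRegularSub G ∧
      Nonempty (G ≃* Multiplicative (ZMod p × ZMod p × ZMod p))) ∧
        Represents G (normalMul ε A C D) := by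
  have h2 := two_ne_zero_zmod h3
  set E := expEquiv ε A C D with hE
  set m := normalMul ε A C D with hm
  have assoc : ∀ u v w, m (m u v) w = m u (m v w) := by
    intro u v w
    rcases mul_eq_zero.mp h with rfl | rfl <;> ext <;> simp only [hm, normalMul_apply] <;> ring
  have E0 : E 0 = 0 := by simp [hE, expEquiv]
  have E_add : ∀ v w, E (v + w) = E v + E w + m (E v) (E w) := expEquiv_add h3 h
  let f : Multiplicative (Vec p) →* Function.End (Heisenberg p) :=
    { toFun := fun v g => (logEquiv p).symm
        (E v.toAdd + logEquiv p g + m (E v.toAdd) (logEquiv p g))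
      map_one' := by
        funext g
        change (logEquiv p).symm (E 0 + logEquiv p g + m (E 0) (logEquiv p g)) = g
        simp [E0]
      map_mul' := by
        intro v w
        funext g
        change (logEquiv p).symm (E (v.toAdd + w.toAdd) + logEquiv p g +
          m (E (v.toAdd + w.toAdd)) (logEquiv p g)) = (logEquiv p).symm
            (E v.toAdd + logEquiv p ((logEquiv p).symm _) +
              m (E v.toAdd) (logEquiv p ((logEquiv p).symm _)))
        rw [Equiv.apply_symm_apply, E_add]
        congr 1
        simp only [map_add, LinearMap.add_apply, assoc]
        abel }
  let F := f.toHomPerm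
  have hF : ∀ v g, logEquiv p (F v g) =
      E v.toAdd + logEquiv p g + m (E v.toAdd) (logEquiv p g) := by
    intro v g
    change logEquiv p ((logEquiv p).symm _) = _
    rw [Equiv.apply_symm_apply]
  have inj : Function.Injective F := by
    intro v w hvw
    have := hF v 1
    rw [hvw, hF] at this
    simpa using this.symm
  refine ⟨F.range, ⟨?_, ?_, ⟨(MonoidHom.ofInjective inj).symm⟩⟩, ?_, ?_⟩
  · rintro _ ⟨v, rfl⟩
    rw [mem_Hol_iff_affine h2]
    refine ⟨E v.toAdd, LinearMap.id + m (E v.toAdd), ?_, fun g => ?_⟩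
    · generalize E v.toAdd = v
      refine ⟨1, 0, ε * v.1, 1, A * v.1 + C * v.2.1, C * v.1 + D * v.2.1, by simp, ?_⟩
      intro x y w
      ext <;> simp [hm, normalMul_apply] <;> ring
    · rw [hF, LinearMap.add_apply, LinearMap.id_apply, add_assoc]
  · intro g h
    obtain ⟨v, hv, huniq⟩ := existsUnique_normalMul ε A C D (logEquiv p g) (logEquiv p h)
    refine ⟨F (Multiplicative.ofAdd (E.symm v)), ⟨⟨_, rfl⟩, (logEquiv p).injective ?_⟩, ?_⟩
    · rw [hF, toAdd_ofAdd, Equiv.apply_symm_apply, hv]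
    · rintro _ ⟨⟨w, rfl⟩, hw⟩
      rw [← huniq (E w.toAdd) (by rw [← hw]; exact (hF w g).symm)]
      simp
  · intro v
    refine ⟨F (Multiplicative.ofAdd (E.symm v)), ⟨_, rfl⟩, fun g => ?_⟩
    rw [hF, toAdd_ofAdd, Equiv.apply_symm_apply]
  · rintro _ ⟨v, rfl⟩
    exact ⟨_, hF v⟩

theorem unipotent_square {M : Module.End (ZMod p) (Vec p)} (hM : IsAutLinear (1 + M))
    (hp : (1 + M) ^ p = 1) :
    M (0, 0, 1) = 0 ∧ ∀ w, (M (M w)).1 = 0 ∧ (M (M w)).2.1 = 0 := by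
  have hchar : CharP (Module.End (ZMod p) (Vec p)) p :=
    charP_of_injective_algebraMap' (ZMod p) p
  have hnil : M ^ p = 0 := by
    rw [add_pow_char_of_commute _ (Commute.one_left M), one_pow] at hp
    simpa using hp
  obtain ⟨a, b, c, d, m, n, hdet, H⟩ := hM
  have hM : ∀ x y w, M (x, y, w) = ((a - 1) * x + b * y, c * x + (d - 1) * y,
      m * x + n * y + (a * d - b * c - 1) * w) := by
    intro x y w
    have := H x y w
    rw [LinearMap.add_apply, Module.End.one_apply, ← eq_sub_iff_add_eq'] at this
    rw [this]
    simp only [Prod.mk_sub_mk, Prod.mk.injEq]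
    refine ⟨by ring, by ring, by ring⟩
  have hδ : a * d - b * c = 1 := by
    have : ∀ k : ℕ, (M ^ k) (0, 0, 1) = (0, 0, (a * d - b * c - 1) ^ k) := by
      intro k
      induction k with
      | zero => simp
      | succ k ih => rw [pow_succ', Module.End.mul_apply, ih, hM]; simp [pow_succ']
    have h0 := this p
    rw [hnil] at h0
    have h1 : (0 : ZMod p) = (a * d - b * c - 1) ^ p := congrArg (fun v : Vec p => v.2.2) h0
    exact sub_eq_zero.mp ((pow_eq_zero_iff (NeZero.ne p)).mp h1.symm)
  simp only [hδ, sub_self, zero_mul, add_zero] at hM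
  have htr : a + d - 2 = 0 := by
    by_contra hs
    have h0 : M * ((a + d - 2) • (1 + M) - M ^ 2) = 0 := by
      refine LinearMap.ext ?_
      rintro ⟨x, y, w⟩
      obtain ⟨t, ht⟩ : ∃ t, ((a + d - 2) • (1 + M) - M ^ 2 : Module.End (ZMod p) (Vec p))
          (x, y, w) = (0, 0, t) := by
        refine ⟨_, Prod.ext ?_ (Prod.ext ?_ rfl)⟩
        · simp [pow_two, hM]
          linear_combination x * hδ
        · simp [pow_two, hM]
          linear_combination y * hδ
      rw [Module.End.mul_apply, ht, hM]
      simp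
    have hu : IsUnit (1 + M) := IsUnit.of_pow_eq_one hp (NeZero.ne p)
    have hu' : IsUnit ((a + d - 2) • (1 + M) - M ^ 2) := by
      have hcomm : Commute M ((a + d - 2) • (1 + M)) :=
        ((Commute.one_right M).add_right (Commute.refl M)).smul_right _
      rw [sub_eq_add_neg]
      refine IsNilpotent.isUnit_add_left_of_commute ?_ (hu.smul (Units.mk0 _ hs)) ?_
      · exact (IsNilpotent.pow_of_pos ⟨p, hnil⟩ two_ne_zero).neg
      · exact (hcomm.pow_left 2).neg_left
    have hM0 : M = 0 := by
      rwa [hu'.mul_left_eq_zero] at h0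
    have h1 := hM 1 0 0
    have h2 := hM 0 1 0
    simp only [hM0, LinearMap.zero_apply, mul_one, mul_zero, add_zero, zero_add,
      eq_comm (a := (0 : Vec p)), Prod.mk_eq_zero] at h1 h2
    exact hs (by linear_combination h1.1 + h2.2.1)
  refine ⟨by simp [hM], ?_⟩
  rintro ⟨x, y, w⟩
  simp only [hM]
  refine ⟨?_, ?_⟩
  · linear_combination (x * a + b * y) * htr - x * hδ
  · linear_combination (d * y + c * x) * htr - y * hδ

/-- The properties of the multiplication attached to an elementary abelian regular subgroup
of the holomorph. -/
structure IsNilMul (m : Vec p →ₗ[ZMod p] Vec p →ₗ[ZMod p] Vec p) : Prop where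
  comm : ∀ v w, m v w = m w v
  assoc : ∀ u v w, m (m u v) w = m u (m v w)
  ann : ∀ v, m v (0, 0, 1) = 0
  sq_fst : ∀ v w, (m v (m v w)).1 = 0
  sq_snd : ∀ v w, (m v (m v w)).2.1 = 0

theorem exists_represents (h2 : (2 : ZMod p) ≠ 0) {G : Subgroup (Equiv.Perm (Heisenberg p))}
    (hG : G ≤ Hol p) (hreg : IsRegularSub G)
    (e : G ≃* Multiplicative (ZMod p × ZMod p × ZMod p)) :
    ∃ m, Represents G m ∧ IsNilMul m := by
  have hcomm : ∀ π ∈ G, ∀ π' ∈ G, π * π' = π' * π := by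
    intro π hπ π' hπ'
    have : (⟨π, hπ⟩ : G) * ⟨π', hπ'⟩ = ⟨π', hπ'⟩ * ⟨π, hπ⟩ :=
      e.injective (by rw [map_mul, map_mul, mul_comm])
    exact congrArg Subtype.val this
  have hpow : ∀ π ∈ G, π ^ p = 1 := by
    intro π hπ
    have : (⟨π, hπ⟩ : G) ^ p = 1 := by
      apply e.injective
      rw [map_pow, map_one]
      apply Multiplicative.toAdd.injective
      rw [toAdd_pow]
      ext <;> simp
    exact congrArg Subtype.val this
  have hex : ∀ v : Vec p, ∃ π ∈ G, ∃ T : Vec p →ₗ[ZMod p] Vec p, IsAutLinear T ∧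
      ∀ g, logEquiv p (π g) = v + T (logEquiv p g) := by
    intro v
    obtain ⟨π, ⟨hπ, h1⟩, -⟩ := hreg 1 ((logEquiv p).symm v)
    obtain ⟨t, T, hT, H⟩ := (mem_Hol_iff_affine h2).mp (hG hπ)
    have := H 1
    rw [h1] at this
    simp at this
    exact ⟨π, hπ, T, hT, by rwa [this]⟩
  choose π hπ T hT H using hex
  have hπ1 : ∀ v, logEquiv p (π v 1) = v := fun v => by simp [H]
  have huniq : ∀ π' ∈ G, π' = π (logEquiv p (π' 1)) := fun π' h =>
    (hreg 1 (π' 1)).unique ⟨h, rfl⟩ ⟨hπ _, (logEquiv p).injective (hπ1 _)⟩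
  have hsymm : ∀ v w, v + T v w = w + T w v := by
    intro v w
    have := congrArg (fun π => logEquiv p (π 1)) (hcomm _ (hπ v) _ (hπ w))
    simpa [H] using this
  have hTT : ∀ v w x, T (v + T v w) x = T v (T w x) := by
    intro v w x
    have h1 := huniq _ (mul_mem (hπ v) (hπ w))
    have h2 := congrArg (fun π => logEquiv p (π ((logEquiv p).symm x))) h1
    simp [H] at h2
    rw [← add_assoc] at h2
    exact (add_left_cancel h2).symm
  let m : Vec p →ₗ[ZMod p] Vec p →ₗ[ZMod p] Vec p := LinearMap.mk₂ (ZMod p)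
    (fun v w => T v w - w)
    (by
      intro u v w
      have e : ∀ v, T v w - w = T w v - v := fun v => by
        rw [sub_eq_sub_iff_add_eq_add, add_comm, hsymm, add_comm]
      rw [e, e, e, map_add]
      abel)
    (by
      intro r v w
      have e : ∀ v, T v w - w = T w v - v := fun v => by
        rw [sub_eq_sub_iff_add_eq_add, add_comm, hsymm, add_comm]
      rw [e, e, map_smul, smul_sub])
    (by intro u v w; rw [map_add]; abel)
    (by intro r v w; rw [map_smul, smul_sub])
  have hm : ∀ v w, m v w = T v w - w := fun v w => rfl
  have hunip : ∀ v, m v (0, 0, 1) = 0 ∧ ∀ w, (m v (m v w)).1 = 0 ∧ (m v (m v w)).2.1 = 0 := by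
    intro v
    have h1 : (1 + m v : Module.End (ZMod p) (Vec p)) = T v := by
      refine LinearMap.ext fun w => ?_
      rw [LinearMap.add_apply, hm, Module.End.one_apply]
      abel
    refine unipotent_square (M := m v) (h1 ▸ hT v) ?_
    rw [h1]
    have iter : ∀ (n : ℕ) x, logEquiv p ((π v ^ n) ((logEquiv p).symm x)) =
        logEquiv p ((π v ^ n) 1) + ((T v : Module.End (ZMod p) (Vec p)) ^ n) x := by
      intro n x
      induction n with
      | zero => simp
      | succ n ih =>
        rw [pow_succ', pow_succ', Equiv.Perm.mul_apply, H, ih, Equiv.Perm.mul_apply, H,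
          Module.End.mul_apply, map_add, add_assoc]
    refine LinearMap.ext fun x => ?_
    have := iter p x
    rw [hpow _ (hπ v)] at this
    simpa using this.symm
  refine ⟨m, ⟨fun v => ⟨π v, hπ v, fun g => ?_⟩, fun π' hπ' => ⟨logEquiv p (π' 1), fun g => ?_⟩⟩,
    ⟨fun v w => ?_, fun u v w => ?_, fun v => (hunip v).1, fun v w => ((hunip v).2 w).1,
      fun v w => ((hunip v).2 w).2⟩⟩
  · rw [H, hm]
    abel
  · rw [huniq π' hπ', H, hm, hπ1]
    abel
  · rw [hm, hm, sub_eq_sub_iff_add_eq_add, add_comm, hsymm, add_comm]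
  · have h1 := hTT u v w
    have h3 : u + T u v = u + v + m u v := by rw [hm]; abel
    have h4 : ∀ v w, T v w = w + m v w := fun v w => by rw [hm]; abel
    rw [h3, h4, h4, h4 v] at h1
    simp only [map_add, LinearMap.add_apply] at h1
    have h5 : (w + (m u w + m v w)) + m (m u v) w = (w + (m u w + m v w)) + m u (m v w) := by
      convert h1 using 1 <;> abel
    exact add_left_cancel h5

/-- Representatives of the isomorphism classes. -/
def normalForm : Option (ZMod p ⊕ ZMod p) → Vec p →ₗ[ZMod p] Vec p →ₗ[ZMod p] Vec p
  | none => normalMul 0 0 0 0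
  | some (.inl d) => normalMul 0 1 0 d
  | some (.inr c) => normalMul 1 0 c 0

theorem IsNilMul.apply_eq {m : Vec p →ₗ[ZMod p] Vec p →ₗ[ZMod p] Vec p} (hm : IsNilMul m)
    (v u f : Vec p) (hf : f.1 = 0 ∧ f.2.1 = 0) (x y w x' y' w' : ZMod p) :
    m (x • v + y • u + w • f) (x' • v + y' • u + w' • f) =
      (x * x') • m v v + (x * y' + y * x') • m v u + (y * y') • m u u := by
  have hf' : f = f.2.2 • (0, 0, 1) := by
    ext <;> simp [hf]
  have ann : ∀ v, m v f = 0 := fun v => by rw [hf', map_smul, hm.ann, smul_zero]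
  have ann' : ∀ v, m f v = 0 := fun v => by rw [hm.comm, ann]
  simp only [map_add, map_smul, LinearMap.add_apply, LinearMap.smul_apply, ann, ann', hm.comm u v]
  module

/-- The linear map with columns `v`, `u` and `det(v, u) e₃`. -/
def frame (v u : Vec p) : Vec p →ₗ[ZMod p] Vec p where
  toFun t := t.1 • v + t.2.1 • u + t.2.2 • (0, 0, v.1 * u.2.1 - u.1 * v.2.1)
  map_add' s t := by
    simp only [Prod.fst_add, Prod.snd_add]
    module
  map_smul' r t := by
    simp only [Prod.smul_fst, Prod.smul_snd, smul_eq_mul, RingHom.id_apply]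
    module

theorem isAutLinear_frame {v u : Vec p} (h : v.1 * u.2.1 - u.1 * v.2.1 ≠ 0) :
    IsAutLinear (frame v u) := by
  refine ⟨v.1, u.1, v.2.1, u.2.1, v.2.2, u.2.2, h, fun x y w => ?_⟩
  ext <;> simp [frame] <;> ring

theorem IsNilMul.exists_frame {m : Vec p →ₗ[ZMod p] Vec p →ₗ[ZMod p] Vec p} (hm : IsNilMul m)
    {v u : Vec p} (h : v.1 * u.2.1 - u.1 * v.2.1 ≠ 0) {ε A C D : ZMod p}
    (hvv : m v v = ε • u + (0, 0, A * (v.1 * u.2.1 - u.1 * v.2.1)))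
    (hvu : m v u = (0, 0, C * (v.1 * u.2.1 - u.1 * v.2.1)))
    (huu : m u u = (0, 0, D * (v.1 * u.2.1 - u.1 * v.2.1))) :
    ∃ T : Vec p →ₗ[ZMod p] Vec p, IsAutLinear T ∧
      ∀ s t, T (normalMul ε A C D s t) = m (T s) (T t) := by
  refine ⟨frame v u, isAutLinear_frame h, fun s t => ?_⟩
  simp only [frame, LinearMap.coe_mk, AddHom.coe_mk]
  rw [hm.apply_eq v u _ ⟨rfl, rfl⟩, hvv, hvu, huu]
  ext <;> simp [normalMul_apply] <;> ring

theorem IsNilMul.exists_normalForm (h2 : (2 : ZMod p) ≠ 0)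
    {m : Vec p →ₗ[ZMod p] Vec p →ₗ[ZMod p] Vec p} (hm : IsNilMul m) :
    ∃ (i : Option (ZMod p ⊕ ZMod p)) (T : Vec p →ₗ[ZMod p] Vec p), IsAutLinear T ∧
      ∀ s t, T (normalForm i s t) = m (T s) (T t) := by
  have polar : ∀ v w, (2 : ZMod p) • m v w = m (v + w) (v + w) - m v v - m w w := by
    intro v w
    simp only [map_add, LinearMap.add_apply, hm.comm w v]
    module
  have ann : ∀ v (k : ZMod p), m v (0, 0, k) = 0 := by
    intro v k
    have : ((0, 0, k) : Vec p) = k • (0, 0, 1) := by ext <;> simp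
    rw [this, map_smul, hm.ann, smul_zero]
  by_cases hB : ∀ v, (m v v).1 = 0 ∧ (m v v).2.1 = 0
  · have hm1 : ∀ v w, (m v w).1 = 0 := by
      intro v w
      have := congrArg Prod.fst (polar v w)
      simpa [hB, h2, -map_add] using this
    have hm2 : ∀ v w, (m v w).2.1 = 0 := by
      intro v w
      have := congrArg (fun t => t.2.1) (polar v w)
      simpa [hB, h2, -map_add] using this
    by_cases h0 : ∀ v, m v v = 0
    · refine ⟨none, LinearMap.id, ⟨1, 0, 0, 1, 0, 0, by simp, by simp⟩, fun s t => ?_⟩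
      have : m s t = 0 := by
        have := polar s t
        rw [h0, h0, h0] at this
        simpa [h2] using this
      simp [normalForm, normalMul_apply, this]
    · push Not at h0
      obtain ⟨v, hv⟩ := h0
      set u : Vec p := (-(m v (0, 1, 0)).2.2, (m v (1, 0, 0)).2.2, 0) with hu
      have expand : ∀ w : Vec p, (m v w).2.2 =
          w.1 * (m v (1, 0, 0)).2.2 + w.2.1 * (m v (0, 1, 0)).2.2 := by
        intro w
        have e : w = w.1 • (1, 0, 0) + w.2.1 • (0, 1, 0) + (0, 0, w.2.2) := by ext <;> simp
        conv_lhs => rw [e, map_add, map_add, map_smul, map_smul, ann]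
        simp
      have hdet : v.1 * u.2.1 - u.1 * v.2.1 = (m v v).2.2 := by
        rw [expand v, hu]
        ring
      have hb : (m v v).2.2 ≠ 0 := fun h => hv (by ext <;> simp [hm1, hm2, h])
      refine ⟨some (.inl ((m u u).2.2 / (m v v).2.2)),
        hm.exists_frame (v := v) (u := u) (hdet ▸ hb) ?_ ?_ ?_⟩
      · ext <;> simp [hm1, hm2, hdet]
      · ext <;> simp [hm1, hm2, expand u]
        simp [hu]
        ring
      · rw [hdet]
        ext <;> simp [hm1, hm2, hb]
  · push Not at hB
    obtain ⟨v, hv⟩ := hB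
    set u := m v v with hu
    have hvu1 : (m v u).1 = 0 := hm.sq_fst v v
    have hvu2 : (m v u).2.1 = 0 := hm.sq_snd v v
    have hvu : m v u = (0, 0, (m v u).2.2) := by ext <;> simp [hvu1, hvu2]
    have huu : m u u = 0 := by
      conv_lhs => rw [hu, hm.assoc, ← hu, hvu, ann]
    have hdet : v.1 * u.2.1 - u.1 * v.2.1 ≠ 0 := by
      intro h0
      have e1 : v.1 • u = u.1 • v + (0, 0, v.1 * u.2.2 - u.1 * v.2.2) := by
        ext <;> simp
        · ring
        · linear_combination h0
      have e2 : v.2.1 • u = u.2.1 • v + (0, 0, v.2.1 * u.2.2 - u.2.1 * v.2.2) := by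
        ext <;> simp
        · linear_combination -h0
        · ring
      have f1 := congrArg (m v) e1
      have f2 := congrArg (m v) e2
      rw [map_add, ann, map_smul, map_smul, ← hu, hvu] at f1 f2
      have g1 := congrArg (fun t : Vec p => t.1) f1
      have g2 := congrArg (fun t : Vec p => t.2.1) f1
      have g3 := congrArg (fun t : Vec p => t.1) f2
      have g4 := congrArg (fun t : Vec p => t.2.1) f2
      simp at g1 g2 g3 g4
      rcases g2 with g2 | g2
      · exact hv g1 g4
      · exact hv g1 g2
    refine ⟨some (.inr ((m v u).2.2 / (v.1 * u.2.1 - u.1 * v.2.1))),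
      hm.exists_frame (v := v) (u := u) hdet ?_ ?_ ?_⟩
    · simp [hu]
    · rw [div_mul_cancel₀ _ hdet]
      exact hvu
    · rw [huu]
      ext <;> simp

theorem normalForm_injective {i j : Option (ZMod p ⊕ ZMod p)} {T : Vec p →ₗ[ZMod p] Vec p}
    (hT : IsAutLinear T)
    (h : ∀ s t, T (normalForm i s t) = normalForm j (T s) (T t)) : i = j := by
  obtain ⟨a, b, c, d, m, n, hdet, hT⟩ := hT
  have h11 := h (1, 0, 0) (1, 0, 0)
  have h12 := h (1, 0, 0) (0, 1, 0)
  have h22 := h (0, 1, 0) (0, 1, 0)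
  rcases i with _ | i | i <;> rcases j with _ | j | j <;>
    simp only [normalForm, normalMul_apply, hT, Prod.mk.injEq, mul_one, mul_zero, zero_mul,
      add_zero, zero_add, one_mul, true_and, zero_eq_mul, or_self] at h11 h12 h22
  all_goals grind

theorem exists_represents_normalForm (h3 : 3 < p) (i : Option (ZMod p ⊕ ZMod p)) :
    ∃ G : Subgroup (Equiv.Perm (Heisenberg p)), (G ≤ Hol p ∧ IsRegularSub G ∧
      Nonempty (G ≃* Multiplicative (ZMod p × ZMod p × ZMod p))) ∧
        Represents G (normalForm i) := by
  rcases i with _ | d | c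
  · exact exists_represents_normalMul h3 (zero_mul _)
  · exact exists_represents_normalMul h3 (zero_mul _)
  · exact exists_represents_normalMul h3 (mul_zero _)

theorem autConj_one (G : Subgroup (Equiv.Perm (Heisenberg p))) : autConj p 1 G = G := by
  simp only [autConj, map_one]
  exact Subgroup.map_id G

theorem autConj_mul (α β : MulAut (Heisenberg p)) (G : Subgroup (Equiv.Perm (Heisenberg p))) :
    autConj p (α * β) G = autConj p α (autConj p β G) := by
  simp only [autConj, map_mul, Subgroup.map_map]
  rfl

/-- Conjugacy under `Aut(M₁)` is an equivalence relation. -/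
theorem equivalence_autConj (P : Subgroup (Equiv.Perm (Heisenberg p)) → Prop) :
    Equivalence fun G G' : {G // P G} => ∃ α : MulAut (Heisenberg p), autConj p α G.1 = G'.1 where
  refl G := ⟨1, autConj_one G.1⟩
  symm := by
    rintro G G' ⟨α, h⟩
    exact ⟨α⁻¹, by rw [← h, ← autConj_mul, inv_mul_cancel, autConj_one]⟩
  trans := by
    rintro G G' G'' ⟨α, h⟩ ⟨β, h'⟩
    exact ⟨β * α, by rw [autConj_mul, h, h']⟩

end Heisenberg

/-- Up to the conjugation action of `Aut(M₁)`, there are exactly `2p + 1`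
regular subgroups of `Hol(M₁)` that are elementary abelian of order `p³`. -/
theorem skew_brace_count_Cp3_M1 (p : ℕ) [Fact p.Prime] (h3 : 3 < p) :
    Nat.card (Quot (fun (G G' : {G : Subgroup (Equiv.Perm (Heisenberg p)) //
        G ≤ Hol p ∧ IsRegularSub G ∧ Nonempty (G ≃* Multiplicative (ZMod p × ZMod p × ZMod p))}) =>
      ∃ α : MulAut (Heisenberg p), autConj p α G.1 = G'.1)) = 2 * p + 1 := by
  have h2 := two_ne_zero_zmod h3
  choose G hG hrep using exists_represents_normalForm h3
  set r := fun (G G' : {G : Subgroup (Equiv.Perm (Heisenberg p)) // G ≤ Hol p ∧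
    IsRegularSub G ∧ Nonempty (G ≃* Multiplicative (ZMod p × ZMod p × ZMod p))}) =>
      ∃ α : MulAut (Heisenberg p), autConj p α G.1 = G'.1
  have hbij : Function.Bijective fun i => Quot.mk r ⟨G i, hG i⟩ := by
    constructor
    · intro i j hij
      obtain ⟨α, hα⟩ := (equivalence_autConj _).eqvGen_iff.mp (Quot.eqvGen_exact hij)
      obtain ⟨T, hT, hαT⟩ := mulAut_exists_isAutLinear h2 α
      exact normalForm_injective hT (((hrep i).autConj_eq_iff (hrep j) hαT).mp hα)
    · rintro ⟨K, hK, hreg, ⟨e⟩⟩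
      obtain ⟨m, hKm, hm⟩ := exists_represents h2 hK hreg e
      obtain ⟨i, T, hT, H⟩ := hm.exists_normalForm h2
      obtain ⟨α, hα⟩ := hT.exists_mulAut h2
      exact ⟨i, Quot.sound ⟨α, ((hrep i).autConj_eq_iff hKm hα).mpr H⟩⟩
  rw [← Nat.card_eq_of_bijective _ hbij, Nat.card_eq_fintype_card, Fintype.card_option,
    Fintype.card_sum, ZMod.card]
  ring
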